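/- Let M be a DC-weight sequence and U ⊆ ℝ^n open. Then the (restrictions to ℝ^n of) entire functions are dense in C^M(U) in the following sense: for every f ∈ C^M(U) and every compact K ⊆ U there exist ρ > 0 and a sequence (f_j) of functions ℝ^n → ℝ, each extending to a holomorphic function ℂ^n → ℂ, such that ‖f − f_j‖_{ρ,K}^M → 0 as j → ∞. -/

import Mathlib

open scoped Nat ENNReal
open Matrix

/-- `f` belongs to the Denjoy–Carleman class `C^M` on the open set `U`. -/
def CMClassOn {E F : Type*} [NormedAddCommGroup E] [NormedSpace ℝ E]
    [NormedAddCommGroup F] [NormedSpace ℝ F]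
    (M : ℕ → ℝ) (U : Set E) (f : E → F) : Prop :=
  ContDiffOn ℝ (⊤ : ℕ∞) f U ∧
    ∀ K : Set E, K ⊆ U → IsCompact K →
      ∃ C > (0 : ℝ), ∃ ρ > (0 : ℝ), ∀ k : ℕ, ∀ x ∈ K,
        ‖iteratedFDerivWithin ℝ k f U x‖ ≤ C * ρ ^ k * (k ! : ℝ) * M k

/-- DC-weight sequence: `M 0 = 1`, positive, increasing, logarithmically convex,
and `sup_k (M (k+1) / M k) ^ (1/k) < ∞`. -/
def DCWeightSeq (M : ℕ → ℝ) : Prop :=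
  M 0 = 1 ∧ (∀ k, 0 < M k) ∧ (∀ k, M k ≤ M (k + 1)) ∧
    (∀ k : ℕ, 1 ≤ k → M k ^ 2 ≤ M (k - 1) * M (k + 1)) ∧
    ∃ C : ℝ, ∀ k : ℕ, 1 ≤ k → (M (k + 1) / M k) ^ ((1 : ℝ) / k) ≤ C

/-- Strong regularity: strong non-quasianalyticity together with moderate growth. -/
def StronglyRegular (N : ℕ → ℝ) : Prop :=
  (∃ C > (0 : ℝ), ∀ j : ℕ,
      ∑' k : ℕ, N (j + k) / (((j + k + 1 : ℕ) : ℝ) * N (j + k + 1)) ≤ C * (N j / N (j + 1))) ∧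
    ∃ C : ℝ, ∀ j k : ℕ, 1 ≤ j → 1 ≤ k →
      (N (j + k) / (N j * N k)) ^ ((1 : ℝ) / ((j : ℝ) + (k : ℝ))) ≤ C

/-- The seminorm `‖f‖_{ρ,K}^M = sup { ‖f^{(k)}(x)‖ / (ρ^k k! M_k) : k ∈ ℕ, x ∈ K }`
(computed in `ℝ≥0∞`; derivatives are taken within `U`). -/
noncomputable def CMNorm {E F : Type*} [NormedAddCommGroup E] [NormedSpace ℝ E]
    [NormedAddCommGroup F] [NormedSpace ℝ F]
    (M : ℕ → ℝ) (ρ : ℝ) (U K : Set E) (f : E → F) : ℝ≥0∞ :=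
  ⨆ (k : ℕ) (x : E) (_ : x ∈ K),
    ENNReal.ofReal (‖iteratedFDerivWithin ℝ k f U x‖ / (ρ ^ k * (k ! : ℝ) * M k))

open MeasureTheory Set Filter Topology Convolution

section ParametricIntegral

theorem hasFDerivAt_setIntegral_of_isCompact {𝕜 H X Z : Type*} [RCLike 𝕜]
    [NormedAddCommGroup H] [NormedSpace 𝕜 H] [ProperSpace H]
    [TopologicalSpace X] [SecondCountableTopology X] [MeasurableSpace X] [OpensMeasurableSpace X]
    [NormedAddCommGroup Z] [NormedSpace ℝ Z] [NormedSpace 𝕜 Z]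
    {μ : Measure X} [IsFiniteMeasureOnCompacts μ] {S : Set X} (hS : IsCompact S)
    (hSm : MeasurableSet S) {F : H → X → Z} {F' : H → X → H →L[𝕜] Z}
    (hF : Continuous (Function.uncurry F)) (hF' : Continuous (Function.uncurry F'))
    (hd : ∀ x y, HasFDerivAt (F · y) (F' x y) x) (x₀ : H) :
    HasFDerivAt (fun x => ∫ y in S, F x y ∂μ) (∫ y in S, F' x₀ y ∂μ) x₀ := by
  obtain ⟨C, hC⟩ := ((isCompact_closedBall x₀ 1).prod hS).exists_bound_of_continuousOn
    hF'.continuousOn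
  have hFx : ∀ x, Continuous (F x) := fun x => hF.comp (by fun_prop : Continuous fun y => (x, y))
  have hF'x : ∀ x, Continuous (F' x) := fun x =>
    hF'.comp (by fun_prop : Continuous fun y => (x, y))
  refine hasFDerivAt_integral_of_dominated_of_fderiv_le (bound := fun _ => C)
    (Metric.closedBall_mem_nhds x₀ zero_lt_one)
    (Eventually.of_forall fun x => (hFx x).continuousOn.aestronglyMeasurable_of_isCompact hS hSm)
    ((hFx x₀).continuousOn.integrableOn_compact' hS hSm)
    ((hF'x x₀).continuousOn.aestronglyMeasurable_of_isCompact hS hSm)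
    ?_ (integrableOn_const (hs := hS.measure_lt_top.ne)) (ae_of_all _ fun y x _ => hd x y)
  filter_upwards [ae_restrict_mem hSm] with y hy x hx
  exact hC (x, y) ⟨hx, hy⟩

variable {E V W Z : Type*} [NormedAddCommGroup E] [NormedSpace ℝ E]
  [NormedAddCommGroup V] [NormedSpace ℝ V] [NormedAddCommGroup W] [NormedSpace ℝ W]
  [NormedAddCommGroup Z] [NormedSpace ℝ Z] [FiniteDimensional ℝ E]
  [MeasurableSpace E] [BorelSpace E] {μ : Measure E} [IsFiniteMeasureOnCompacts μ]

theorem hasFDerivAt_setIntegral_bilinear (L : V →L[ℝ] W →L[ℝ] Z) {S : Set E} (hS : IsCompact S)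
    {ψ : E → V} (hψ : Continuous ψ) {k : E → W} (hk : ContDiff ℝ 1 k) (x : E) :
    HasFDerivAt (fun x => ∫ y in S, L (ψ y) (k (x - y)) ∂μ)
      (∫ y in S, L.precompR E (ψ y) (fderiv ℝ k (x - y)) ∂μ) x := by
  have : ProperSpace E := FiniteDimensional.proper_real E
  have hk' := hk.continuous_fderiv one_ne_zero
  have hkc := hk.continuous
  refine hasFDerivAt_setIntegral_of_isCompact hS hS.measurableSet
    (F := fun x y => L (ψ y) (k (x - y)))
    (F' := fun x y => L.precompR E (ψ y) (fderiv ℝ k (x - y))) ?_ ?_ ?_ x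
  · simp only [Function.uncurry_def]; fun_prop
  · simp only [Function.uncurry_def]; fun_prop
  · intro x y
    have h : HasFDerivAt (fun x => k (x - y)) (fderiv ℝ k (x - y)) x := by
      simpa using! (hk.differentiable one_ne_zero).differentiableAt.hasFDerivAt.comp x
        ((hasFDerivAt_id x).sub (hasFDerivAt_const y x))
    exact (L (ψ y)).hasFDerivAt.comp x h

end ParametricIntegral

theorem norm_iteratedFDeriv_setIntegral_bilinear_le {E V W Z : Type}
    [NormedAddCommGroup E] [NormedSpace ℝ E]
    [NormedAddCommGroup V] [NormedSpace ℝ V] [NormedAddCommGroup W] [NormedSpace ℝ W]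
    [NormedAddCommGroup Z] [NormedSpace ℝ Z] [FiniteDimensional ℝ E]
    [MeasurableSpace E] [BorelSpace E] {μ : Measure E} [IsFiniteMeasureOnCompacts μ]
    (L : V →L[ℝ] W →L[ℝ] Z) (hL : ‖L‖ ≤ 1) {S : Set E} (hS : IsCompact S)
    {ψ : E → V} (hψ : Continuous ψ) {c : ℝ} (hc : ∀ y ∈ S, ‖ψ y‖ ≤ c)
    {k : E → W} (hk : ContDiff ℝ (⊤ : ℕ∞) k) (m : ℕ) {g : ℝ} (x : E) (hg : ∀ y ∈ S, ‖iteratedFDeriv ℝ m k (x - y)‖ ≤ g) :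
    ‖iteratedFDeriv ℝ m (fun x => ∫ y in S, L (ψ y) (k (x - y)) ∂μ) x‖
      ≤ c * g * μ.real S := by
  rcases S.eq_empty_or_nonempty with rfl | ⟨y₀, hy₀⟩
  · simp
  have hc0 : 0 ≤ c := (norm_nonneg _).trans (hc _ hy₀)
  have hg0 : 0 ≤ g := (norm_nonneg _).trans (hg _ hy₀)
  induction m generalizing W Z with
  | zero =>
    rw [norm_iteratedFDeriv_zero]
    refine norm_setIntegral_le_of_norm_le_const hS.measure_lt_top fun y hy => ?_
    have := hg y hy
    rw [norm_iteratedFDeriv_zero] at this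
    calc ‖L (ψ y) (k (x - y))‖ ≤ ‖L‖ * ‖ψ y‖ * ‖k (x - y)‖ := L.le_opNorm₂ _ _
      _ ≤ 1 * c * g := by gcongr; exact hc y hy
      _ = c * g := by rw [one_mul]
  | succ m ih =>
    rw [← norm_iteratedFDeriv_fderiv,
      funext fun x => (hasFDerivAt_setIntegral_bilinear (μ := μ) L hS hψ
        (hk.of_le (mod_cast le_top)) x).fderiv]
    refine ih (L.precompR E) ((ContinuousLinearMap.norm_precompR_le E L).trans hL)
      (hk.fderiv_right (m := (⊤ : ℕ∞)) le_rfl) (fun y hy => ?_)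
    rw [norm_iteratedFDeriv_fderiv]
    exact hg y hy

section SmoothCutoff

variable {E V : Type*} [NormedAddCommGroup E] [NormedSpace ℝ E]
  [NormedAddCommGroup V] [NormedSpace ℝ V] {χ : E → ℝ} {f : E → V}

theorem fderiv_smul_eq_add_smulRightL (hχ : Differentiable ℝ χ) (hf : Differentiable ℝ f) :
    fderiv ℝ (fun y => χ y • f y) =
      (fun y => χ y • fderiv ℝ f y) +
        fun y => ContinuousLinearMap.smulRightL ℝ E V (fderiv ℝ χ y) (f y) := by
  ext1 y
  rw [fderiv_fun_smul (hχ y) (hf y)]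
  rfl

theorem norm_fderiv_smul_le_of_bounds (hχ : Differentiable ℝ χ) (hf : Differentiable ℝ f)
    (hχ01 : ∀ y, χ y ∈ Icc (0 : ℝ) 1) {c : ℝ} (hc : ∀ y, ‖fderiv ℝ χ y‖ ≤ c) {B₀ B₁ : ℝ}
    (hB₀ : ∀ y ∈ tsupport χ, ‖f y‖ ≤ B₀) (hB₁ : ∀ y ∈ tsupport χ, ‖fderiv ℝ f y‖ ≤ B₁)
    (hn : (tsupport χ).Nonempty) (y : E) :
    ‖fderiv ℝ (fun y => χ y • f y) y‖ ≤ c * B₀ + B₁ := by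
  obtain ⟨y₀, hy₀⟩ := hn
  have hc0 : 0 ≤ c := (norm_nonneg _).trans (hc y₀)
  have hB₀0 : 0 ≤ B₀ := (norm_nonneg _).trans (hB₀ _ hy₀)
  have hB₁0 : 0 ≤ B₁ := (norm_nonneg _).trans (hB₁ _ hy₀)
  by_cases hy : y ∈ tsupport χ
  · rw [fderiv_fun_smul (hχ y) (hf y), add_comm]
    refine (norm_add_le _ _).trans (add_le_add ?_ ?_)
    · rw [ContinuousLinearMap.norm_smulRight_apply]
      exact mul_le_mul (hc y) (hB₀ y hy) (norm_nonneg _) hc0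
    · rw [norm_smul, Real.norm_of_nonneg (hχ01 y).1]
      exact (mul_le_of_le_one_left (norm_nonneg _) (hχ01 y).2).trans (hB₁ y hy)
  · have h : y ∉ tsupport (fun y => χ y • f y) := fun h => hy (tsupport_smul_subset_left χ f h)
    have : fderiv ℝ (fun y => χ y • f y) y = 0 :=
      Function.notMem_support.1 fun h' => h (support_fderiv_subset ℝ h')
    rw [this, norm_zero]
    positivity

end SmoothCutoff

section Mollification

variable {E : Type*} [NormedAddCommGroup E] [NormedSpace ℝ E] [FiniteDimensional ℝ E]
  [MeasurableSpace E] [BorelSpace E] {μ : Measure E} [μ.IsAddHaarMeasure]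

theorem norm_convolution_sub_le_of_lipschitz {V : Type*} [NormedAddCommGroup V] [NormedSpace ℝ V]
    [CompleteSpace V] {ξ : E → V} (hξ : Continuous ξ) (hξc : HasCompactSupport ξ)
    {Λ : ℝ} (hΛ : ∀ y z, ‖ξ y - ξ z‖ ≤ Λ * ‖y - z‖)
    {k : E → ℝ} (hk0 : ∀ z, 0 ≤ k z) (hki : Integrable k μ)
    (hk1 : ∫ z, k z ∂μ = 1) (hkn : Integrable (fun z => ‖z‖ * k z) μ) (x : E) :
    ‖(ξ ⋆[(ContinuousLinearMap.lsmul ℝ ℝ).flip, μ] k) x - ξ x‖ ≤ Λ * ∫ z, ‖z‖ * k z ∂μ := by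
  have hint : Integrable (fun z => k z • ξ (x - z)) μ := by
    obtain ⟨C, hC⟩ := hξc.exists_bound_of_continuous hξ
    exact hki.smul_bdd C (by fun_prop) (ae_of_all _ fun z => hC _)
  have hint' : Integrable (fun z => k z • ξ x) μ := hki.smul_const _
  have h1 : ξ x = ∫ z, k z • ξ x ∂μ := by rw [integral_smul_const, hk1, one_smul]
  rw [convolution_eq_swap]
  simp only [ContinuousLinearMap.flip_apply, ContinuousLinearMap.lsmul_apply]
  conv_lhs => rw [h1]
  rw [← integral_sub hint hint', ← integral_const_mul]
  refine norm_integral_le_of_norm_le (hkn.const_mul _) (ae_of_all _ fun z => ?_)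
  rw [← smul_sub, norm_smul, Real.norm_of_nonneg (hk0 z)]
  have := hΛ (x - z) x
  rw [sub_sub_cancel_left, norm_neg] at this
  nlinarith [mul_le_mul_of_nonneg_left this (hk0 z)]

end Mollification

theorem norm_iteratedFDeriv_succ_sub {E V : Type*} [NormedAddCommGroup E] [NormedSpace ℝ E]
    [NormedAddCommGroup V] [NormedSpace ℝ V] (f g : E → V) (m : ℕ) (x : E) :
    ‖iteratedFDeriv ℝ (m + 1) f x - iteratedFDeriv ℝ (m + 1) g x‖ =
      ‖iteratedFDeriv ℝ m (fderiv ℝ f) x - iteratedFDeriv ℝ m (fderiv ℝ g) x‖ := by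
  rw [iteratedFDeriv_succ_eq_comp_right, iteratedFDeriv_succ_eq_comp_right, Function.comp_apply,
    Function.comp_apply,
    ← (continuousMultilinearCurryRightEquiv' ℝ m E V).symm.norm_map
      (iteratedFDeriv ℝ m (fderiv ℝ f) x - iteratedFDeriv ℝ m (fderiv ℝ g) x)]
  exact congrArg norm (LinearIsometryEquiv.map_sub _ _ _).symm

theorem norm_lsmul_flip_le (V : Type*) [NormedAddCommGroup V] [NormedSpace ℝ V] :
    ‖(ContinuousLinearMap.lsmul ℝ ℝ : ℝ →L[ℝ] V →L[ℝ] V).flip‖ ≤ 1 := by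
  rw [ContinuousLinearMap.opNorm_flip]
  exact ContinuousLinearMap.opNorm_lsmul_le

theorem norm_iteratedFDeriv_convolution_sub_le {E V : Type}
    [NormedAddCommGroup E] [NormedSpace ℝ E] [FiniteDimensional ℝ E]
    [MeasurableSpace E] [BorelSpace E] {μ : Measure E} [μ.IsAddHaarMeasure]
    [NormedAddCommGroup V] [NormedSpace ℝ V] [CompleteSpace V]
    {χ : E → ℝ} (hχ : ContDiff ℝ (⊤ : ℕ∞) χ) (hχc : HasCompactSupport χ)
    (hχ01 : ∀ y, χ y ∈ Icc (0 : ℝ) 1) {c : ℝ} (hc : ∀ y, ‖fderiv ℝ χ y‖ ≤ c)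
    {k : E → ℝ} (hk0 : ∀ z, 0 ≤ k z) (hk : ContDiff ℝ (⊤ : ℕ∞) k) (hki : Integrable k μ)
    (hk1 : ∫ z, k z ∂μ = 1) (hkn : Integrable (fun z => ‖z‖ * k z) μ)
    {x : E} (hx : χ x = 1) {g : ℕ → ℝ}
    (hg : ∀ j, ∀ y ∈ tsupport (fderiv ℝ χ), ‖iteratedFDeriv ℝ j k (x - y)‖ ≤ g j)
    {f : E → V} (hf : ContDiff ℝ (⊤ : ℕ∞) f) {B : ℕ → ℝ}
    (hB : ∀ j, ∀ y ∈ tsupport χ, ‖iteratedFDeriv ℝ j f y‖ ≤ B j) (m : ℕ) :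
    ‖iteratedFDeriv ℝ m
        ((fun y => χ y • f y) ⋆[(ContinuousLinearMap.lsmul ℝ ℝ).flip, μ] k) x
      - iteratedFDeriv ℝ m f x‖ ≤
      (c * B m + B (m + 1)) * (∫ z, ‖z‖ * k z ∂μ) +
        c * μ.real (tsupport (fderiv ℝ χ)) * ∑ i ∈ Finset.range m, B i * g (m - 1 - i) := by
  have hxs : x ∈ tsupport χ := subset_tsupport _ (by simp [hx])
  have hχd : Differentiable ℝ χ := hχ.differentiable (by simp)
  have hkl : LocallyIntegrable k μ := hki.locallyIntegrable
  induction m generalizing V B with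
  | zero =>
    have hfd : Differentiable ℝ f := hf.differentiable (by simp)
    have hξ : Differentiable ℝ (fun y => χ y • f y) := hχd.fun_smul hfd
    have hB₀ : ∀ y ∈ tsupport χ, ‖f y‖ ≤ B 0 := fun y hy => by simpa using hB 0 y hy
    have hB₁ : ∀ y ∈ tsupport χ, ‖fderiv ℝ f y‖ ≤ B 1 := fun y hy => by
      have := hB 1 y hy
      rwa [← norm_iteratedFDeriv_fderiv, norm_iteratedFDeriv_zero] at this
    have key := norm_convolution_sub_le_of_lipschitz (μ := μ) hξ.continuous
      (hχc.smul_right (f' := f))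
      (fun y z => convex_univ.norm_image_sub_le_of_norm_fderiv_le (fun w _ => hξ w)
        (fun w _ => norm_fderiv_smul_le_of_bounds hχd hfd hχ01 hc hB₀ hB₁ ⟨x, hxs⟩ w)
        (mem_univ z) (mem_univ y)) hk0 hki hk1 hkn x
    rw [hx, one_smul] at key
    simp only [Finset.range_zero, Finset.sum_empty, mul_zero, add_zero]
    rw [iteratedFDeriv_zero_eq_comp, iteratedFDeriv_zero_eq_comp, Function.comp_apply,
      Function.comp_apply, ← map_sub, LinearIsometryEquiv.norm_map]
    exact key
  | succ m ih =>
    have hfd : Differentiable ℝ f := hf.differentiable (by simp)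
    have hf' : ContDiff ℝ (⊤ : ℕ∞) (fderiv ℝ f) := hf.fderiv_right (m := (⊤ : ℕ∞)) le_rfl
    have hχ' : ContDiff ℝ (⊤ : ℕ∞) (fderiv ℝ χ) := hχ.fderiv_right (m := (⊤ : ℕ∞)) le_rfl
    set L' : (E →L[ℝ] V) →L[ℝ] ℝ →L[ℝ] (E →L[ℝ] V) := (ContinuousLinearMap.lsmul ℝ ℝ).flip
    set R : E → E →L[ℝ] V :=
      fun y => ContinuousLinearMap.smulRightL ℝ E V (fderiv ℝ χ y) (f y) with hR
    have hRs : ContDiff ℝ (⊤ : ℕ∞) R := by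
      simp only [hR]
      exact ((ContinuousLinearMap.smulRightL ℝ E V).contDiff.comp hχ').clm_apply hf
    have hRsupp : Function.support R ⊆ tsupport (fderiv ℝ χ) := fun y hy => by
      by_contra h
      exact hy (by simp [hR, image_eq_zero_of_notMem_tsupport h])
    have hS : IsCompact (tsupport (fderiv ℝ χ)) := hχc.fderiv ℝ
    have hRc : HasCompactSupport R := HasCompactSupport.of_support_subset_isCompact hS hRsupp
    have hQc : HasCompactSupport (fun y => χ y • f y) := hχc.smul_right
    have hPc : HasCompactSupport (fun y => χ y • fderiv ℝ f y) := hχc.smul_right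
    have hPs : ContDiff ℝ (⊤ : ℕ∞) (fun y => χ y • fderiv ℝ f y) := hχ.smul hf'
    have hD : fderiv ℝ ((fun y => χ y • f y) ⋆[(ContinuousLinearMap.lsmul ℝ ℝ).flip, μ] k) =
        ((fun y => χ y • fderiv ℝ f y) ⋆[L', μ] k) + (R ⋆[L', μ] k) := by
      ext1 w
      rw [(hQc.hasFDerivAt_convolution_left _
        ((hχ.smul hf).of_le (mod_cast le_top)) hkl w).fderiv, fderiv_smul_eq_add_smulRightL hχd hfd]
      have hL : (ContinuousLinearMap.lsmul ℝ ℝ).flip.precompL E = L' := by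
        ext; rfl
      rw [hL, ConvolutionExistsAt.add_distrib]
      · rfl
      · exact hPc.convolutionExists_left _ hPs.continuous hkl w
      · exact hRc.convolutionExists_left _ hRs.continuous hkl w
    have hRk : R ⋆[L', μ] k = fun x => ∫ y in tsupport (fderiv ℝ χ), L' (R y) (k (x - y)) ∂μ := by
      ext1 w
      rw [convolution_def, setIntegral_eq_integral_of_forall_compl_eq_zero]
      intro y hy
      rw [Function.notMem_support.1 fun h => hy (hRsupp h), map_zero, _root_.zero_apply]
    have hRn : ∀ y ∈ tsupport (fderiv ℝ χ), ‖R y‖ ≤ c * B 0 := fun y hy => by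
      have h1 : ‖f y‖ ≤ B 0 := by
        simpa using hB 0 y (closure_minimal (support_fderiv_subset ℝ) (isClosed_tsupport χ) hy)
      refine (ContinuousLinearMap.norm_smulRight_apply (fderiv ℝ χ y) (f y)).trans_le ?_
      exact mul_le_mul (hc y) h1 (norm_nonneg _) ((norm_nonneg _).trans (hc y))
    have hm : (m : WithTop ℕ∞) ≤ ((⊤ : ℕ∞) : WithTop ℕ∞) := mod_cast le_top
    have hRb := norm_iteratedFDeriv_setIntegral_bilinear_le (μ := μ) L'
      (norm_lsmul_flip_le (E →L[ℝ] V)) hS hRs.continuous hRn hk m x (hg m)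
    rw [← hRk] at hRb
    have hind := ih hf' (B := fun j => B (j + 1)) fun j y hy => by
      rw [norm_iteratedFDeriv_fderiv]; exact hB (j + 1) y hy
    rw [norm_iteratedFDeriv_succ_sub, hD, iteratedFDeriv_add,
      Pi.add_apply, add_sub_right_comm]
    · refine (norm_add_le _ _).trans ((add_le_add hind hRb).trans ?_)
      have hsum : ∑ i ∈ Finset.range m, B (i + 1) * g (m + 1 - 1 - (i + 1)) =
          ∑ i ∈ Finset.range m, B (i + 1) * g (m - 1 - i) :=
        Finset.sum_congr rfl fun i _ => by congr 2; omega
      rw [Finset.sum_range_succ', hsum, Nat.add_sub_cancel, Nat.sub_zero, mul_add, ← add_assoc]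
      refine add_le_add le_rfl (le_of_eq (by ring))
    · exact (hPc.contDiff_convolution_left L' hPs hkl).of_le hm
    · exact (hRc.contDiff_convolution_left L' hRs hkl).of_le hm

section Gaussian

theorem mul_pow_le_exp_of_two_term_recurrence {a : ℕ → ℝ} (ha : ∀ k, 0 ≤ a k) {τ R u : ℝ}
    (hτ : 0 ≤ τ) (hR : 0 ≤ R) (h₁ : a 1 ≤ 2 * τ * (R * a 0))
    (h : ∀ k : ℕ, (k + 2) * a (k + 2) ≤ 2 * τ * (R * a (k + 1) + a k)) (hu : 0 ≤ u) (k : ℕ) :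
    a k * u ^ k ≤ a 0 * Real.exp (τ * (2 * R * u + u ^ 2)) := by
  set S : ℕ → ℝ → ℝ := fun n x => ∑ i ∈ Finset.range (n + 1), a i * x ^ i with hS
  have hSd : ∀ n x, HasDerivAt (S n) (∑ i ∈ Finset.range n, (i + 1) * a (i + 1) * x ^ i) x := by
    intro n x
    have h := HasDerivAt.fun_sum (u := Finset.range (n + 1)) (A := fun i x => a i * x ^ i)
      (A' := fun i => a i * (i * x ^ (i - 1))) (x := x)
      fun i _ => (hasDerivAt_pow i x).const_mul (a i)
    refine h.congr_deriv ?_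
    rw [Finset.sum_range_succ']
    simp only [Nat.cast_zero, zero_mul, mul_zero, add_zero, Nat.add_sub_cancel]
    refine Finset.sum_congr rfl fun i _ => ?_
    push_cast; ring
  have hmono : ∀ n x, 0 ≤ x → ∑ i ∈ Finset.range n, a i * x ^ i ≤ S n x := by
    intro n x hx
    simp only [hS, Finset.sum_range_succ]
    have := mul_nonneg (ha n) (pow_nonneg hx n)
    linarith
  have hbound : ∀ n x, 0 ≤ x →
      ∑ i ∈ Finset.range n, (i + 1) * a (i + 1) * x ^ i ≤ 2 * τ * (R + x) * S n x := by
    intro n x hx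
    rcases n with _ | n
    · simp only [Finset.range_zero, Finset.sum_empty]
      have := Finset.sum_nonneg fun i (_ : i ∈ Finset.range (0 + 1)) =>
        mul_nonneg (ha i) (pow_nonneg hx i)
      positivity
    · calc ∑ i ∈ Finset.range (n + 1), (i + 1) * a (i + 1) * x ^ i
          ≤ 2 * τ * (R * ∑ i ∈ Finset.range (n + 1), a i * x ^ i
              + x * ∑ i ∈ Finset.range n, a i * x ^ i) := by
            rw [Finset.sum_range_succ', Finset.sum_range_succ' (fun i => a i * x ^ i)]
            simp only [Finset.mul_sum, mul_add]
            have : ∀ i ∈ Finset.range n, ((i + 1 : ℕ) + 1) * a (i + 1 + 1) * x ^ (i + 1) ≤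
                2 * τ * (R * (a (i + 1) * x ^ (i + 1))) + 2 * τ * (x * (a i * x ^ i)) := by
              intro i _
              have h1 := mul_le_mul_of_nonneg_right (h i) (pow_nonneg hx (i + 1))
              push_cast
              have e : ((i : ℝ) + 1 + 1) = i + 2 := by ring
              rw [e]
              refine h1.trans (le_of_eq ?_)
              ring
            have h2 := Finset.sum_le_sum this
            rw [Finset.sum_add_distrib] at h2
            simp only [Nat.cast_zero, zero_add, one_mul, pow_zero, mul_one]
            linarith
        _ ≤ 2 * τ * (R * S (n + 1) x + x * S (n + 1) x) := by
            have h1 := hmono (n + 1) x hx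
            have h2 := hmono n x hx
            gcongr
            exact h2.trans h1
        _ = _ := by ring
  set e : ℝ → ℝ := fun x => Real.exp (-(τ * (2 * R * x + x ^ 2))) with he
  have hed : ∀ x, HasDerivAt e (e x * (-(τ * (2 * R + 2 * x)))) x := by
    intro x
    refine HasDerivAt.exp ?_
    have := ((((hasDerivAt_id x).const_mul (2 * R)).add (hasDerivAt_pow 2 x)).const_mul τ).neg
    refine this.congr_deriv ?_
    simp
  have hanti : AntitoneOn (fun x => S k x * e x) (Ici 0) := by
    refine antitoneOn_of_deriv_nonpos (convex_Ici 0) ?_ ?_ ?_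
    · exact fun x _ => ((hSd k x).mul (hed x)).continuousAt.continuousWithinAt
    · exact fun x _ => ((hSd k x).mul (hed x)).differentiableAt.differentiableWithinAt
    · intro x hx
      rw [interior_Ici, mem_Ioi] at hx
      have := ((hSd k x).mul (hed x)).deriv
      simp only [Pi.mul_def] at this
      rw [this]
      have h1 := mul_le_mul_of_nonneg_right (hbound k x hx.le) (Real.exp_pos _ : 0 < e x).le
      nlinarith
  have h0 := hanti (mem_Ici.2 le_rfl) (mem_Ici.2 hu) hu
  have hS0 : S k 0 = a 0 := by
    simp [hS, Finset.sum_range_succ']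
  have he0 : e 0 = 1 := by simp [he]
  simp only [hS0, he0, mul_one] at h0
  have hterm : a k * u ^ k ≤ S k u :=
    Finset.single_le_sum (f := fun i => a i * u ^ i)
      (fun i _ => mul_nonneg (ha i) (pow_nonneg hu i)) (Finset.self_mem_range_succ k)
  have hee : e u * Real.exp (τ * (2 * R * u + u ^ 2)) = 1 := by
    rw [he, ← Real.exp_add, neg_add_cancel, Real.exp_zero]
  calc a k * u ^ k ≤ S k u := hterm
    _ = S k u * e u * Real.exp (τ * (2 * R * u + u ^ 2)) := by rw [mul_assoc, hee, mul_one]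
    _ ≤ _ := mul_le_mul_of_nonneg_right h0 (Real.exp_pos _).le

theorem norm_iteratedFDeriv_clm_eq_zero {E W : Type*} [NormedAddCommGroup E] [NormedSpace ℝ E]
    [NormedAddCommGroup W] [NormedSpace ℝ W] (T : E →L[ℝ] W) (j : ℕ) (z : E) :
    iteratedFDeriv ℝ (j + 2) T z = 0 := by
  rw [← norm_eq_zero, ← norm_iteratedFDeriv_fderiv]
  have : fderiv ℝ T = fun _ => T := by ext1 x; exact T.fderiv
  rw [this, iteratedFDeriv_const_of_ne (by omega)]
  simp

/-- Derivative bounds for the exponential of a quadratic form given by a bounded bilinear form. -/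
theorem norm_iteratedFDeriv_exp_neg_quadratic_le {E : Type*} [NormedAddCommGroup E]
    [NormedSpace ℝ E] (T : E →L[ℝ] E →L[ℝ] ℝ) (hT : ∀ x y, T x y = T y x) {N t R u : ℝ}
    (hN : ‖T‖ ≤ N) (ht : 0 ≤ t) (hu : 0 < u) {z : E} (hz : ‖z‖ ≤ R) (k : ℕ) :
    ‖iteratedFDeriv ℝ k (fun z => Real.exp (-(t * T z z))) z‖ ≤
      Real.exp (-(t * T z z)) * Real.exp (t * N * (2 * R * u + u ^ 2)) * (k.factorial : ℝ) / u ^ k := by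
  set G : E → ℝ := fun z => Real.exp (-(t * T z z)) with hG
  have hR : 0 ≤ R := (norm_nonneg _).trans hz
  have hN0 : 0 ≤ N := (norm_nonneg T).trans hN
  have hq : ContDiff ℝ (⊤ : ℕ∞) fun z => T z z := T.contDiff.clm_apply contDiff_id
  have hGs : ContDiff ℝ (⊤ : ℕ∞) G := (contDiff_const.mul hq).neg.exp
  obtain ⟨T', hT'⟩ : ∃ T' : E →L[ℝ] E →L[ℝ] ℝ, T' = (-(2 * t)) • T := ⟨_, rfl⟩
  have hT'n : ‖T'‖ ≤ 2 * t * N := by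
    rw [hT']
    refine (ContinuousLinearMap.opNorm_smul_le _ _).trans ?_
    rw [norm_neg, Real.norm_of_nonneg (by positivity)]
    gcongr
  have hGd : fderiv ℝ G = fun z => G z • T' z := by
    ext1 z
    have h1 : HasFDerivAt (fun z => T z z) ((2 : ℝ) • T z) z := by
      have := T.hasFDerivAt.clm_apply (hasFDerivAt_id z)
      refine this.congr_fderiv ?_
      ext w
      simp [hT w z]
      ring
    refine ((h1.const_mul t).neg.exp).fderiv.trans ?_
    ext w
    simp [hT', hG]
    ring
  set a : ℕ → ℝ := fun k => ‖iteratedFDeriv ℝ k G z‖ / (k.factorial : ℝ) with ha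
  have hT0 : ‖iteratedFDeriv ℝ 0 T' z‖ ≤ 2 * t * N * R := by
    rw [norm_iteratedFDeriv_zero]
    exact (ContinuousLinearMap.le_opNorm _ _).trans (by gcongr)
  have hT1 : ‖iteratedFDeriv ℝ 1 T' z‖ ≤ 2 * t * N := by
    rw [← norm_iteratedFDeriv_fderiv, norm_iteratedFDeriv_zero, ContinuousLinearMap.fderiv]
    exact hT'n
  have hleib : ∀ k, ‖iteratedFDeriv ℝ (k + 1) G z‖ ≤ ∑ i ∈ Finset.range (k + 1),
      (k.choose i : ℝ) * ‖iteratedFDeriv ℝ i G z‖ *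
        ‖iteratedFDeriv ℝ (k - i) T' z‖ := fun k => by
    rw [← norm_iteratedFDeriv_fderiv, hGd]
    exact norm_iteratedFDeriv_smul_le hGs T'.contDiff z (mod_cast le_top)
  have key := mul_pow_le_exp_of_two_term_recurrence (a := a) (τ := t * N) (R := R) (u := u)
    (fun k => by positivity) (by positivity) hR ?_ ?_ hu.le k
  · have ha0 : a 0 = G z := by
      simp [ha, hG, abs_of_pos (Real.exp_pos _)]
    rw [ha0] at key
    rw [le_div_iff₀ (pow_pos hu k)]
    have hk : (0 : ℝ) < (k.factorial : ℝ) := mod_cast k.factorial_pos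
    calc ‖iteratedFDeriv ℝ k G z‖ * u ^ k = a k * u ^ k * (k.factorial : ℝ) := by
          simp only [ha]; field_simp
      _ ≤ _ := by
          refine (mul_le_mul_of_nonneg_right key hk.le).trans (le_of_eq ?_)
          simp only [hG]
  · have := hleib 0
    simp only [zero_add, Finset.sum_range_one, Nat.choose_self, Nat.cast_one,
      one_mul] at this
    simp only [ha, Nat.factorial_one, Nat.factorial_zero, Nat.cast_one, div_one]
    nlinarith [mul_le_mul_of_nonneg_left hT0 (norm_nonneg (iteratedFDeriv ℝ 0 G z))]
  · intro k
    have h2 := hleib (k + 1)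
    rw [Finset.sum_range_succ, Finset.sum_range_succ, Finset.sum_eq_zero, zero_add] at h2
    · rw [Nat.choose_self, Nat.sub_self, Nat.choose_succ_self_right,
        show k + 1 - k = 1 by omega] at h2
      have h3 := mul_le_mul_of_nonneg_left hT0 (norm_nonneg (iteratedFDeriv ℝ (k + 1) G z))
      have h4 := mul_le_mul_of_nonneg_left hT1 (norm_nonneg (iteratedFDeriv ℝ k G z))
      have h5 : ‖iteratedFDeriv ℝ (k + 2) G z‖ ≤ 2 * (t * N) *
          (R * ‖iteratedFDeriv ℝ (k + 1) G z‖ + (k + 1) * ‖iteratedFDeriv ℝ k G z‖) := by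
        have h6 := mul_le_mul_of_nonneg_left h4 (by positivity : (0 : ℝ) ≤ k + 1)
        push_cast at h2
        linarith
      have hk : (0 : ℝ) < (k.factorial : ℝ) := mod_cast k.factorial_pos
      simp only [ha, Nat.factorial_succ]
      push_cast
      have e1 : ((k : ℝ) + 2) * (‖iteratedFDeriv ℝ (k + 2) G z‖ / (((k : ℝ) + 1 + 1) *
          (((k : ℝ) + 1) * (k.factorial : ℝ)))) =
          ‖iteratedFDeriv ℝ (k + 2) G z‖ / (((k : ℝ) + 1) * (k.factorial : ℝ)) := by
        have : (k : ℝ) + 1 + 1 = k + 2 := by ring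
        rw [this]; field_simp
      have e2 : 2 * (t * N) * (R * (‖iteratedFDeriv ℝ (k + 1) G z‖ / (((k : ℝ) + 1) * (k.factorial : ℝ)))
          + ‖iteratedFDeriv ℝ k G z‖ / (k.factorial : ℝ)) = 2 * (t * N) *
          (R * ‖iteratedFDeriv ℝ (k + 1) G z‖ + (k + 1) * ‖iteratedFDeriv ℝ k G z‖) /
            (((k : ℝ) + 1) * (k.factorial : ℝ)) := by field_simp
      rw [e1, e2]
      gcongr
    · intro i hi
      rw [Finset.mem_range] at hi
      obtain ⟨d, rfl⟩ := Nat.exists_eq_add_of_lt hi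
      have : i + d + 1 + 1 - i = d + 2 := by omega
      rw [this, norm_iteratedFDeriv_clm_eq_zero]
      simp

end Gaussian

section Weights

theorem DCWeightSeq.monotone {M : ℕ → ℝ} (hM : DCWeightSeq M) : Monotone M :=
  monotone_nat_of_le_succ hM.2.2.1

theorem DCWeightSeq.exists_succ_le {M : ℕ → ℝ} (hM : DCWeightSeq M) :
    ∃ A : ℝ, 1 ≤ A ∧ ∃ B : ℝ, 0 ≤ B ∧ ∀ k, M (k + 1) ≤ B * A ^ k * M k := by
  obtain ⟨h0, hpos, -, -, C, hC⟩ := hM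
  refine ⟨max 1 C, le_max_left _ _, max 1 (M 1), zero_le_one.trans (le_max_left _ _), fun k => ?_⟩
  rcases Nat.eq_zero_or_pos k with rfl | hk
  · simp [h0]
  · have h1 := hC k hk
    have hq : 0 ≤ M (k + 1) / M k := (div_pos (hpos _) (hpos _)).le
    have h2 : M (k + 1) / M k ≤ (max 1 C) ^ k := by
      calc M (k + 1) / M k = ((M (k + 1) / M k) ^ ((1 : ℝ) / k)) ^ k := by
            rw [one_div, Real.rpow_inv_natCast_pow hq hk.ne']
        _ ≤ _ := pow_le_pow_left₀ (Real.rpow_nonneg hq _) (h1.trans (le_max_right _ _)) k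
    rw [div_le_iff₀ (hpos k)] at h2
    refine h2.trans ?_
    rw [mul_assoc]
    exact le_mul_of_one_le_left
      (mul_nonneg (pow_nonneg (zero_le_one.trans (le_max_left _ _)) _) (hpos k).le) (le_max_left _ _)

theorem sum_mul_factorial_div_pow_le {M : ℕ → ℝ} (hM : Monotone M) (hM0 : ∀ k, 0 ≤ M k)
    {C r u ε P : ℝ} (hC : 0 ≤ C) (hr : 0 ≤ r) (hu : 0 < u) (hε : 0 ≤ ε) (hrP : r ≤ P)
    (huP : 1 / u ≤ P) (hP : 1 ≤ P) (m : ℕ) :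
    ∑ i ∈ Finset.range m, (C * r ^ i * (i.factorial : ℝ) * M i) *
        (ε * ((m - 1 - i).factorial : ℝ) / u ^ (m - 1 - i)) ≤
      C * ε * (P ^ m * (m.factorial : ℝ) * M m) := by
  rcases m with _ | m
  · have := hM0 0
    simp only [Finset.range_zero, Finset.sum_empty]
    positivity
  have hP0 : 0 ≤ P := zero_le_one.trans hP
  have hterm : ∀ i ∈ Finset.range (m + 1), (C * r ^ i * (i.factorial : ℝ) * M i) *
        (ε * ((m + 1 - 1 - i).factorial : ℝ) / u ^ (m + 1 - 1 - i)) ≤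
      C * ε * (P ^ (m + 1) * (m.factorial : ℝ) * M (m + 1)) := by
    intro i hi
    have him : i ≤ m := Nat.lt_succ_iff.1 (Finset.mem_range.1 hi)
    obtain ⟨d, rfl⟩ := Nat.exists_eq_add_of_le him
    have e : i + d + 1 - 1 - i = d := by omega
    rw [e]
    have hf : (i.factorial : ℝ) * (d.factorial : ℝ) ≤ ((i + d).factorial : ℝ) := by
      exact_mod_cast Nat.le_of_dvd (Nat.factorial_pos _)
        (Nat.factorial_mul_factorial_dvd_factorial_add i d)
    have hMi : M i ≤ M (i + d + 1) := hM (by omega)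
    have h0 := hM0 i
    calc (C * r ^ i * (i.factorial : ℝ) * M i) * (ε * (d.factorial : ℝ) / u ^ d)
        = C * ε * ((r ^ i * (1 / u) ^ d) * ((i.factorial : ℝ) * (d.factorial : ℝ)) * M i) := by
          rw [one_div, inv_pow]; field_simp
      _ ≤ C * ε * ((P ^ i * P ^ d) * ((i + d).factorial : ℝ) * M (i + d + 1)) := by gcongr
      _ ≤ C * ε * (P ^ (i + d + 1) * ((i + d).factorial : ℝ) * M (i + d + 1)) := by
          have h1 := hM0 (i + d + 1)
          have h2 : P ^ i * P ^ d ≤ P ^ (i + d + 1) := by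
            rw [← pow_add]
            exact pow_le_pow_right₀ hP (Nat.le_succ _)
          gcongr
  refine (Finset.sum_le_card_nsmul _ _ _ hterm).trans (le_of_eq ?_)
  rw [Finset.card_range, nsmul_eq_mul, Nat.factorial_succ]
  push_cast; ring

theorem error_le_mul_pow_factorial {M : ℕ → ℝ} (hM : Monotone M) (hM0 : ∀ k, 0 ≤ M k)
    {A B : ℝ} (hA : 1 ≤ A) (hAB : ∀ k, M (k + 1) ≤ B * A ^ k * M k)
    {C r u ε P c v η : ℝ} (hC : 0 ≤ C) (hr : 0 ≤ r) (hu : 0 < u) (hε : 0 ≤ ε) (hrP : r ≤ P)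
    (huP : 1 / u ≤ P) (hP : 1 ≤ P) (hc : 0 ≤ c) (hv : 0 ≤ v) (hη : 0 ≤ η) (m : ℕ) :
    (c * (C * r ^ m * (m.factorial : ℝ) * M m) +
          C * r ^ (m + 1) * ((m + 1).factorial : ℝ) * M (m + 1)) * η +
        c * v * ∑ i ∈ Finset.range m, (C * r ^ i * (i.factorial : ℝ) * M i) *
          (ε * ((m - 1 - i).factorial : ℝ) / u ^ (m - 1 - i)) ≤
      (C * (c + r * B) * η + c * v * C * ε) *
        ((2 * P * A) ^ m * (m.factorial : ℝ) * M m) := by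
  have hP0 : 0 ≤ P := zero_le_one.trans hP
  have hA0 : 0 ≤ A := zero_le_one.trans hA
  have hMm := hM0 m
  have hm2 : ((m : ℝ) + 1) ≤ 2 ^ m := by
    have : m + 1 ≤ 2 ^ m := Nat.lt_two_pow_self
    exact_mod_cast this
  have h1 : c * (C * r ^ m * (m.factorial : ℝ) * M m) ≤
      C * c * ((2 * P * A) ^ m * (m.factorial : ℝ) * M m) := by
    have : r ≤ 2 * P * A := by nlinarith
    calc c * (C * r ^ m * (m.factorial : ℝ) * M m) = C * c * (r ^ m * (m.factorial : ℝ) * M m) := by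
          ring
      _ ≤ _ := by gcongr
  have h2 : C * r ^ (m + 1) * ((m + 1).factorial : ℝ) * M (m + 1) ≤
      C * (r * B) * ((2 * P * A) ^ m * (m.factorial : ℝ) * M m) := by
    calc C * r ^ (m + 1) * ((m + 1).factorial : ℝ) * M (m + 1)
        = C * r * (r ^ m * ((m : ℝ) + 1) * (m.factorial : ℝ) * M (m + 1)) := by
          rw [Nat.factorial_succ]; push_cast; ring
      _ ≤ C * r * (P ^ m * 2 ^ m * (m.factorial : ℝ) * (B * A ^ m * M m)) := by
          have := hM0 (m + 1)
          gcongr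
          exact hAB m
      _ = _ := by ring
  have h3 := sum_mul_factorial_div_pow_le hM hM0 hC hr hu hε hrP huP hP m
  have h4 : C * ε * (P ^ m * (m.factorial : ℝ) * M m) ≤
      C * ε * ((2 * P * A) ^ m * (m.factorial : ℝ) * M m) := by
    have : P ≤ 2 * P * A := by nlinarith
    gcongr
  have h5 := mul_le_mul_of_nonneg_left (h3.trans h4) (mul_nonneg hc hv)
  have h6 := mul_le_mul_of_nonneg_right (add_le_add h1 h2) hη
  refine (add_le_add h6 h5).trans (le_of_eq ?_)
  ring

end Weights

section Kernel

variable (n : ℕ)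

/-- The Euclidean inner product on `Fin n → ℝ` as a continuous bilinear form. -/
noncomputable def dotProductCLM : (Fin n → ℝ) →L[ℝ] (Fin n → ℝ) →L[ℝ] ℝ :=
  ∑ i, (ContinuousLinearMap.proj i : (Fin n → ℝ) →L[ℝ] ℝ).smulRight
    (ContinuousLinearMap.proj i : (Fin n → ℝ) →L[ℝ] ℝ)

variable {n}

theorem dotProductCLM_apply (z w : Fin n → ℝ) : dotProductCLM n z w = ∑ i, z i * w i := by
  simp [dotProductCLM]

theorem dotProductCLM_comm (z w : Fin n → ℝ) : dotProductCLM n z w = dotProductCLM n w z := by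
  simp only [dotProductCLM_apply, mul_comm]

theorem norm_sq_le_dotProductCLM_self (z : Fin n → ℝ) : ‖z‖ ^ 2 ≤ dotProductCLM n z z := by
  have h0 : ∀ i ∈ Finset.univ, 0 ≤ z i * z i := fun i _ => mul_self_nonneg _
  rw [dotProductCLM_apply]
  refine (Real.le_sqrt (norm_nonneg _) (Finset.sum_nonneg h0)).1 ?_
  refine (pi_norm_le_iff_of_nonneg (Real.sqrt_nonneg _)).2 fun i => ?_
  refine Real.le_sqrt_of_sq_le ?_
  rw [Real.norm_eq_abs, sq_abs, sq]
  exact Finset.single_le_sum (f := fun i => z i * z i) h0 (Finset.mem_univ i)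

theorem continuous_dotProductCLM_self : Continuous fun z => dotProductCLM n z z :=
  (dotProductCLM n).continuous.clm_apply continuous_id

theorem integrable_exp_neg_mul_dotProductCLM {a : ℝ} (ha : 0 < a) :
    Integrable fun z => Real.exp (-(a * dotProductCLM n z z)) := by
  have h := Integrable.fintype_prod (f := fun (_ : Fin n) (x : ℝ) => Real.exp (-a * x ^ 2))
    (μ := fun _ => volume) fun _ => integrable_exp_neg_mul_sq ha
  refine h.congr (ae_of_all _ fun z => ?_)
  simp only [dotProductCLM_apply, ← Real.exp_sum, Finset.mul_sum, ← Finset.sum_neg_distrib]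
  congr 1
  exact Finset.sum_congr rfl fun i _ => by ring

theorem integrable_norm_mul_exp_neg_dotProductCLM :
    Integrable fun z : Fin n → ℝ => ‖z‖ * Real.exp (-(dotProductCLM n z z)) := by
  refine (integrable_exp_neg_mul_dotProductCLM (n := n) (a := 1 / 2) (by norm_num)).mono'
    (continuous_norm.mul continuous_dotProductCLM_self.neg.rexp).aestronglyMeasurable
    (ae_of_all _ fun z => ?_)
  rw [Real.norm_of_nonneg (mul_nonneg (norm_nonneg _) (Real.exp_pos _).le)]
  have h1 : ‖z‖ ≤ Real.exp (1 / 2 * dotProductCLM n z z) := by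
    have := Real.add_one_le_exp (1 / 2 * dotProductCLM n z z)
    have := norm_sq_le_dotProductCLM_self z
    nlinarith [sq_nonneg (‖z‖ - 1)]
  calc ‖z‖ * Real.exp (-(dotProductCLM n z z))
      ≤ Real.exp (1 / 2 * dotProductCLM n z z) * Real.exp (-(dotProductCLM n z z)) := by gcongr
    _ = _ := by rw [← Real.exp_add]; congr 1; ring

/-- The total mass of the standard Gaussian weight. -/
noncomputable def gaussianMass (n : ℕ) : ℝ := ∫ z, Real.exp (-(dotProductCLM n z z))

theorem gaussianMass_pos : 0 < gaussianMass n := by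
  have hi := integrable_exp_neg_mul_dotProductCLM (n := n) one_pos
  simp only [one_mul] at hi
  refine (integral_pos_iff_support_of_nonneg (fun z => (Real.exp_pos _).le) hi).2 ?_
  have : Function.support (fun z => Real.exp (-(dotProductCLM n z z))) = univ :=
    eq_univ_of_forall fun z => (Real.exp_pos _).ne'
  rw [this]
  exact isOpen_univ.measure_pos _ univ_nonempty

/-- The normalized Gaussian kernel with inverse width `s`. -/
noncomputable def gaussianKernel (n : ℕ) (s : ℝ) (z : Fin n → ℝ) : ℝ :=
  s ^ n / gaussianMass n * Real.exp (-(s ^ 2 * dotProductCLM n z z))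

theorem gaussianKernel_eq (s : ℝ) (z : Fin n → ℝ) : gaussianKernel n s z =
    s ^ n / gaussianMass n * Real.exp (-(dotProductCLM n (s • z) (s • z))) := by
  simp only [gaussianKernel, map_smul, _root_.smul_apply, smul_eq_mul]
  ring_nf

theorem gaussianKernel_nonneg {s : ℝ} (hs : 0 ≤ s) (z : Fin n → ℝ) : 0 ≤ gaussianKernel n s z :=
  mul_nonneg (div_nonneg (pow_nonneg hs _) gaussianMass_pos.le) (Real.exp_pos _).le

theorem contDiff_exp_neg_mul_dotProductCLM (a : ℝ) :
    ContDiff ℝ (⊤ : ℕ∞) fun z => Real.exp (-(a * dotProductCLM n z z)) :=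
  (contDiff_const.mul ((dotProductCLM n).contDiff.clm_apply contDiff_id)).neg.exp

theorem contDiff_gaussianKernel (s : ℝ) : ContDiff ℝ (⊤ : ℕ∞) (gaussianKernel n s) :=
  contDiff_const.mul (contDiff_exp_neg_mul_dotProductCLM _)

theorem integrable_gaussianKernel {s : ℝ} (hs : 0 < s) : Integrable (gaussianKernel n s) :=
  (integrable_exp_neg_mul_dotProductCLM (pow_pos hs 2)).const_mul _

theorem integral_gaussianKernel {s : ℝ} (hs : 0 < s) : ∫ z, gaussianKernel n s z = 1 := by
  have h := Measure.integral_comp_smul (volume : Measure (Fin n → ℝ))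
    (fun z => Real.exp (-(dotProductCLM n z z))) s
  simp only [gaussianKernel_eq]
  rw [integral_const_mul, h, Module.finrank_fin_fun, abs_of_pos (by positivity), smul_eq_mul]
  change s ^ n / gaussianMass n * ((s ^ n)⁻¹ * gaussianMass n) = 1
  have := (gaussianMass_pos (n := n)).ne'
  field_simp

theorem norm_mul_gaussianKernel {s : ℝ} (hs : 0 < s) (z : Fin n → ℝ) :
    ‖z‖ * gaussianKernel n s z = s ^ n / gaussianMass n * s⁻¹ *
      (‖s • z‖ * Real.exp (-(dotProductCLM n (s • z) (s • z)))) := by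
  rw [gaussianKernel_eq, norm_smul, Real.norm_of_nonneg hs.le]
  field_simp

theorem integrable_norm_mul_gaussianKernel {s : ℝ} (hs : 0 < s) :
    Integrable fun z => ‖z‖ * gaussianKernel n s z := by
  simp only [norm_mul_gaussianKernel hs]
  exact (integrable_norm_mul_exp_neg_dotProductCLM.comp_smul hs.ne').const_mul _

theorem integral_norm_mul_gaussianKernel {s : ℝ} (hs : 0 < s) :
    ∫ z, ‖z‖ * gaussianKernel n s z = (∫ z, ‖z‖ * gaussianKernel n 1 z) * s⁻¹ := by
  have h := Measure.integral_comp_smul (volume : Measure (Fin n → ℝ))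
    (fun z => ‖z‖ * Real.exp (-(dotProductCLM n z z))) s
  simp only [norm_mul_gaussianKernel hs, norm_mul_gaussianKernel one_pos, one_smul]
  rw [integral_const_mul, integral_const_mul, h, Module.finrank_fin_fun,
    abs_of_pos (by positivity), smul_eq_mul]
  field_simp
  simp

theorem norm_iteratedFDeriv_gaussianKernel_le {s R u δ : ℝ} (hs : 0 ≤ s) (hu : 0 < u)
    (huδ : ‖dotProductCLM n‖ * (2 * R * u + u ^ 2) ≤ δ ^ 2 / 2) (hδ : 0 ≤ δ) {z : Fin n → ℝ}
    (hz : ‖z‖ ≤ R) (hzδ : δ ≤ ‖z‖) (k : ℕ) :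
    ‖iteratedFDeriv ℝ k (gaussianKernel n s) z‖ ≤
      s ^ n / gaussianMass n * Real.exp (-(s ^ 2 * (δ ^ 2 / 2))) * (k.factorial : ℝ) / u ^ k := by
  have hc : 0 ≤ s ^ n / gaussianMass n := div_nonneg (pow_nonneg hs _) gaussianMass_pos.le
  have h1 : iteratedFDeriv ℝ k (gaussianKernel n s) z = (s ^ n / gaussianMass n) •
      iteratedFDeriv ℝ k (fun z => Real.exp (-(s ^ 2 * dotProductCLM n z z))) z :=
    iteratedFDeriv_const_smul_apply' (a := s ^ n / gaussianMass n)
      ((contDiff_exp_neg_mul_dotProductCLM (s ^ 2)).of_le (mod_cast le_top)).contDiffAt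
  have h2 := norm_iteratedFDeriv_exp_neg_quadratic_le (dotProductCLM n) dotProductCLM_comm le_rfl
    (sq_nonneg s) hu hz k
  rw [h1, norm_smul, Real.norm_of_nonneg hc, mul_assoc, mul_div_assoc]
  refine mul_le_mul_of_nonneg_left (h2.trans ?_) hc
  rw [← Real.exp_add]
  have h3 : δ ^ 2 ≤ dotProductCLM n z z :=
    (pow_le_pow_left₀ hδ hzδ 2).trans (norm_sq_le_dotProductCLM_self z)
  have h4 := mul_le_mul_of_nonneg_left huδ (sq_nonneg s)
  have h5 := mul_le_mul_of_nonneg_left h3 (sq_nonneg s)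
  gcongr
  linarith

theorem tendsto_pow_mul_exp_neg_sq_mul (m : ℕ) {b : ℝ} (hb : 0 < b) :
    Tendsto (fun s : ℝ => s ^ m * Real.exp (-(s ^ 2 * b))) atTop (𝓝 0) := by
  have h := (rpow_mul_exp_neg_mul_sq_isLittleO_exp_neg hb m).isBigO.trans_tendsto
    (Real.tendsto_exp_atBot.comp (tendsto_id.const_mul_atTop_of_neg (by norm_num)))
  refine h.congr fun s => ?_
  rw [Real.rpow_natCast, mul_comm (s ^ 2), neg_mul]

end Kernel

section EntireExtension

variable {n : ℕ}

theorem exists_entire_extension_convolution_gaussianKernel {ψ : (Fin n → ℝ) → ℝ}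
    (hψ : Continuous ψ) (hψc : HasCompactSupport ψ) (s : ℝ) :
    ∃ g : (Fin n → ℂ) → ℂ, Differentiable ℂ g ∧ ∀ x : Fin n → ℝ, g (fun i => (x i : ℂ)) =
      ((ψ ⋆[(ContinuousLinearMap.lsmul ℝ ℝ).flip, volume] gaussianKernel n s) x : ℝ) := by
  set F : (Fin n → ℂ) → (Fin n → ℝ) → ℂ := fun z y =>
    (s ^ n / gaussianMass n * ψ y : ℝ) * Complex.exp (-(s ^ 2 * ∑ i, (z i - y i) ^ 2)) with hF
  set F' : (Fin n → ℂ) → (Fin n → ℝ) → (Fin n → ℂ) →L[ℂ] ℂ := fun z y =>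
    ∑ i, (-(F z y * (s ^ 2 * (2 * (z i - y i))))) •
      (ContinuousLinearMap.proj i : (Fin n → ℂ) →L[ℂ] ℂ) with hF'
  have hFc : Continuous (Function.uncurry F) := by
    simp only [hF, Function.uncurry_def]
    fun_prop
  have hF'c : Continuous (Function.uncurry F') := by
    simp only [hF, hF', Function.uncurry_def]
    fun_prop
  have hd : ∀ z y, HasFDerivAt (F · y) (F' z y) z := by
    intro z y
    have h1 : HasFDerivAt (fun z : Fin n → ℂ => ∑ i, (z i - y i) ^ 2)
        (∑ i, (2 * (z i - y i)) • (ContinuousLinearMap.proj i : (Fin n → ℂ) →L[ℂ] ℂ)) z := by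
      refine HasFDerivAt.fun_sum fun i _ => ?_
      refine (((hasFDerivAt_apply i z).sub_const (y i : ℂ)).pow 2).congr_fderiv ?_
      ext w
      simp
    refine (((h1.const_mul ((s : ℂ) ^ 2)).neg.cexp).const_mul ((s ^ n / gaussianMass n * ψ y : ℝ) : ℂ)).congr_fderiv ?_
    ext w
    simp [hF', hF, Finset.mul_sum]
    exact Finset.sum_congr rfl fun i _ => by ring
  refine ⟨fun z => ∫ y in tsupport ψ, F z y, fun z =>
    (hasFDerivAt_setIntegral_of_isCompact hψc.isCompact (isClosed_tsupport ψ).measurableSet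
      hFc hF'c hd z).differentiableAt, fun x => ?_⟩
  have hx : ∀ y, F (fun i => (x i : ℂ)) y = ((gaussianKernel n s (x - y) * ψ y : ℝ) : ℂ) := by
    intro y
    simp only [hF, gaussianKernel, dotProductCLM_apply, Pi.sub_apply, ← sq]
    push_cast
    ring
  simp only [hx]
  rw [setIntegral_eq_integral_of_forall_compl_eq_zero, integral_complex_ofReal]
  · rfl
  · intro y hy
    rw [image_eq_zero_of_notMem_tsupport hy]
    simp

end EntireExtension

section Cutoff

variable {E : Type*} [NormedAddCommGroup E] [NormedSpace ℝ E] [FiniteDimensional ℝ E]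

theorem exists_contDiff_cutoff {K U : Set E} (hK : IsCompact K) (hU : IsOpen U) (hKU : K ⊆ U) :
    ∃ χ : E → ℝ, ContDiff ℝ (⊤ : ℕ∞) χ ∧ HasCompactSupport χ ∧ tsupport χ ⊆ U ∧
      (∀ y, χ y ∈ Icc (0 : ℝ) 1) ∧ ∀ x ∈ K, χ =ᶠ[𝓝 x] fun _ => 1 := by
  obtain ⟨L, hL, hKL, hLU⟩ := exists_compact_between hK hU hKU
  obtain ⟨χ, h1, h0, hI⟩ := exists_contMDiffMap_one_nhds_of_subset_interior (n := (⊤ : ℕ∞))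
    (modelWithCornersSelf ℝ E) hK.isClosed hKL
  have hs : tsupport χ ⊆ L := closure_minimal
    (fun x hx => by_contra fun hxL => hx (h0 x hxL)) hL.isClosed
  exact ⟨χ, χ.contMDiff.contDiff, HasCompactSupport.of_support_subset_isCompact hL
    ((subset_tsupport _).trans hs), hs.trans hLU, hI,
    fun x hx => h1.filter_mono (nhds_le_nhdsSet hx)⟩

theorem ContDiffOn.exists_contDiff_eventuallyEq {V : Type*} [NormedAddCommGroup V]
    [NormedSpace ℝ V] {f : E → V} {K U : Set E} (hK : IsCompact K) (hU : IsOpen U) (hKU : K ⊆ U)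
    (hf : ContDiffOn ℝ (⊤ : ℕ∞) f U) :
    ∃ F : E → V, ContDiff ℝ (⊤ : ℕ∞) F ∧ ∀ x ∈ K, F =ᶠ[𝓝 x] f := by
  obtain ⟨χ, hχ, -, hχU, -, hχ1⟩ := exists_contDiff_cutoff hK hU hKU
  refine ⟨fun x => χ x • f x, contDiff_iff_contDiffAt.2 fun x => ?_, fun x hx => ?_⟩
  · by_cases hx : x ∈ tsupport χ
    · exact hχ.contDiffAt.smul (hf.contDiffAt (hU.mem_nhds (hχU hx)))
    · refine (contDiffAt_const (c := (0 : V))).congr_of_eventuallyEq ?_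
      filter_upwards [notMem_tsupport_iff_eventuallyEq.1 hx] with y hy
      simp [hy]
  · filter_upwards [hχ1 x hx] with y hy
    simp [hy]

end Cutoff

section Separation

variable {E : Type*} [NormedAddCommGroup E]

theorem IsCompact.exists_norm_sub_bounds {K D : Set E} (hK : IsCompact K) (hD : IsCompact D)
    (hKD : Disjoint K D) :
    ∃ δ > (0 : ℝ), ∃ R : ℝ, 0 ≤ R ∧ ∀ x ∈ K, ∀ y ∈ D, δ ≤ ‖x - y‖ ∧ ‖x - y‖ ≤ R := by
  have hQ : IsCompact ((fun p : E × E => p.1 - p.2) '' (K ×ˢ D)) :=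
    (hK.prod hD).image (by fun_prop)
  have h0 : (0 : E) ∈ ((fun p : E × E => p.1 - p.2) '' (K ×ˢ D))ᶜ := by
    rintro ⟨⟨x, y⟩, ⟨hx, hy⟩, hxy⟩
    exact hKD.le_bot ⟨hx, (sub_eq_zero.1 hxy) ▸ hy⟩
  obtain ⟨δ, hδ, hball⟩ := Metric.isOpen_iff.1 hQ.isClosed.isOpen_compl 0 h0
  obtain ⟨R, hR⟩ := hQ.isBounded.exists_norm_le
  refine ⟨δ, hδ, max R 0, le_max_right _ _, fun x hx y hy => ?_⟩
  have hm : x - y ∈ (fun p : E × E => p.1 - p.2) '' (K ×ˢ D) := ⟨(x, y), ⟨hx, hy⟩, rfl⟩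
  refine ⟨?_, (hR _ hm).trans (le_max_left _ _)⟩
  by_contra! h
  exact hball (mem_ball_zero_iff.2 h) hm

theorem exists_pos_mul_le (N R : ℝ) {b : ℝ} (hb : 0 < b) :
    ∃ u > (0 : ℝ), N * (2 * R * u + u ^ 2) ≤ b := by
  have hc : Continuous fun u : ℝ => N * (2 * R * u + u ^ 2) := by fun_prop
  have ht : Tendsto (fun u : ℝ => N * (2 * R * u + u ^ 2)) (𝓝[>] 0) (𝓝 0) :=
    (hc.tendsto' 0 0 (by simp)).mono_left nhdsWithin_le_nhds
  obtain ⟨u, hu, hu0⟩ := ((ht.eventually_le_const hb).and self_mem_nhdsWithin).exists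
  exact ⟨u, hu0, hu⟩

end Separation

theorem CMNorm_le_ofReal {E F : Type*} [NormedAddCommGroup E] [NormedSpace ℝ E]
    [NormedAddCommGroup F] [NormedSpace ℝ F] {M : ℕ → ℝ} (hM : ∀ k, 0 < M k) {ρ : ℝ} (hρ : 0 < ρ)
    {U K : Set E} {f : E → F} {e : ℝ}
    (h : ∀ k, ∀ x ∈ K, ‖iteratedFDerivWithin ℝ k f U x‖ ≤ e * (ρ ^ k * (k.factorial : ℝ) * M k)) :
    CMNorm M ρ U K f ≤ ENNReal.ofReal e := by
  refine iSup_le fun k => iSup_le fun x => iSup_le fun hx => ENNReal.ofReal_le_ofReal ?_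
  have := hM k
  have hk : (0 : ℝ) < (k.factorial : ℝ) := mod_cast k.factorial_pos
  exact (div_le_iff₀ (by positivity)).2 (h k x hx)

/-- Convolution with narrow Gaussian kernels approximates in the Denjoy–Carleman seminorms. -/
theorem exists_norm_iteratedFDeriv_convolution_gaussianKernel_sub_le {n : ℕ} {M : ℕ → ℝ}
    (hM : DCWeightSeq M) {χ f : (Fin n → ℝ) → ℝ} (hχ : ContDiff ℝ (⊤ : ℕ∞) χ)
    (hχc : HasCompactSupport χ) (hχ01 : ∀ y, χ y ∈ Icc (0 : ℝ) 1) {K : Set (Fin n → ℝ)}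
    (hK : IsCompact K) (hχK : ∀ x ∈ K, χ =ᶠ[𝓝 x] fun _ => 1) (hf : ContDiff ℝ (⊤ : ℕ∞) f)
    {C r : ℝ} (hC : 0 ≤ C) (hr : 0 ≤ r) (hB : ∀ j, ∀ y ∈ tsupport χ,
      ‖iteratedFDeriv ℝ j f y‖ ≤ C * r ^ j * (j.factorial : ℝ) * M j) :
    ∃ ρ > (0 : ℝ), ∃ e : ℝ → ℝ, Tendsto e atTop (𝓝 0) ∧ ∀ s > (0 : ℝ), ∀ x ∈ K, ∀ m : ℕ,
      ‖iteratedFDeriv ℝ m ((fun y => χ y • f y) ⋆[(ContinuousLinearMap.lsmul ℝ ℝ).flip, volume]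
          gaussianKernel n s) x - iteratedFDeriv ℝ m f x‖ ≤
        e s * (ρ ^ m * (m.factorial : ℝ) * M m) := by
  have hM0 : ∀ k, 0 ≤ M k := fun k => (hM.2.1 k).le
  obtain ⟨A, hA, B, -, hAB⟩ := hM.exists_succ_le
  have hχ'c : HasCompactSupport (fderiv ℝ χ) := hχc.fderiv (𝕜 := ℝ)
  obtain ⟨c, hc⟩ := hχ'c.exists_bound_of_continuous (hχ.continuous_fderiv (by simp))
  have hc0 : 0 ≤ c := (norm_nonneg _).trans (hc 0)
  have hdisj : Disjoint K (tsupport (fderiv ℝ χ)) := by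
    refine Set.disjoint_left.2 fun x hx => notMem_tsupport_iff_eventuallyEq.2 ?_
    refine (hχK x hx).fderiv.trans (Eventually.of_forall fun y => ?_)
    simp
  obtain ⟨δ, hδ, R, -, hδR⟩ := hK.exists_norm_sub_bounds hχ'c.isCompact hdisj
  obtain ⟨u, hu, huδ⟩ := exists_pos_mul_le ‖dotProductCLM n‖ R (half_pos (pow_pos hδ 2))
  set P : ℝ := max (max r (1 / u)) 1 with hP
  have hP1 : 1 ≤ P := le_max_right _ _
  set ε : ℝ → ℝ := fun s => s ^ n / gaussianMass n * Real.exp (-(s ^ 2 * (δ ^ 2 / 2))) with hε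
  set η : ℝ → ℝ := fun s => ∫ z, ‖z‖ * gaussianKernel n s z with hη
  set v : ℝ := volume.real (tsupport (fderiv ℝ χ)) with hv
  refine ⟨2 * P * A, by positivity, fun s => C * (c + r * B) * η s + c * v * C * ε s, ?_,
    fun s hs x hx m => ?_⟩
  · have hε0 : Tendsto ε atTop (𝓝 0) := by
      have h := (tendsto_pow_mul_exp_neg_sq_mul n (half_pos (pow_pos hδ 2))).const_mul
        (gaussianMass n)⁻¹
      rw [mul_zero] at h
      refine h.congr fun s => ?_
      simp only [hε]; ring
    have hη0 : Tendsto η atTop (𝓝 0) := by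
      have h := tendsto_inv_atTop_zero.const_mul (∫ z, ‖z‖ * gaussianKernel n 1 z)
      rw [mul_zero] at h
      refine h.congr' ?_
      filter_upwards [eventually_gt_atTop (0 : ℝ)] with s hs
      exact (integral_norm_mul_gaussianKernel hs).symm
    simpa using (hη0.const_mul (C * (c + r * B))).add (hε0.const_mul (c * v * C))
  · have hεs : 0 ≤ ε s :=
      mul_nonneg (div_nonneg (pow_nonneg hs.le _) gaussianMass_pos.le) (Real.exp_pos _).le
    have hηs : 0 ≤ η s :=
      integral_nonneg fun z => mul_nonneg (norm_nonneg _) (gaussianKernel_nonneg hs.le z)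
    refine (norm_iteratedFDeriv_convolution_sub_le hχ hχc hχ01 hc (gaussianKernel_nonneg hs.le)
      (contDiff_gaussianKernel s) (integrable_gaussianKernel hs) (integral_gaussianKernel hs)
      (integrable_norm_mul_gaussianKernel hs) (hχK x hx).self_of_nhds
      (g := fun j => ε s * (j.factorial : ℝ) / u ^ j) (fun j y hy => ?_) hf hB m).trans ?_
    · exact norm_iteratedFDeriv_gaussianKernel_le hs.le hu huδ hδ.le (hδR x hx y hy).2
        (hδR x hx y hy).1 j
    · exact error_le_mul_pow_factorial hM.monotone hM0 hA hAB hC hr hu hεs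
        ((le_max_left _ _).trans (le_max_left _ _)) ((le_max_right _ _).trans (le_max_left _ _))
        hP1 hc0 measureReal_nonneg hηs m

/-- Entire functions are dense in `C^M(U)`: for `f ∈ C^M(U)` and compact
`K ⊆ U` there are `ρ > 0` and functions `f_j`, each extending to a holomorphic function
`ℂⁿ → ℂ`, with `‖f - f_j‖_{ρ,K}^M → 0`. -/
theorem entire_functions_dense_in_CM
    (n : ℕ) (M : ℕ → ℝ) (hM : DCWeightSeq M)
    (U : Set (Fin n → ℝ)) (hU : IsOpen U)
    (f : (Fin n → ℝ) → ℝ) (hf : CMClassOn M U f)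
    (K : Set (Fin n → ℝ)) (hK : IsCompact K) (hKU : K ⊆ U) :
    ∃ ρ > (0 : ℝ), ∃ fseq : ℕ → (Fin n → ℝ) → ℝ,
      (∀ j : ℕ, ∃ g : (Fin n → ℂ) → ℂ, Differentiable ℂ g ∧
        ∀ x : Fin n → ℝ, g (fun i => (x i : ℂ)) = ((fseq j x : ℝ) : ℂ)) ∧
      Filter.Tendsto (fun j => CMNorm M ρ U K (f - fseq j)) Filter.atTop (nhds 0) := by
  obtain ⟨hfs, hfb⟩ := hf
  obtain ⟨χ, hχ, hχc, hχU, hχ01, hχK⟩ := exists_contDiff_cutoff hK hU hKU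
  obtain ⟨F, hF, hFf⟩ := hfs.exists_contDiff_eventuallyEq hχc.isCompact hU hχU
  obtain ⟨C, hC, r, hr, hCr⟩ := hfb (tsupport χ) hχU hχc.isCompact
  have hFb : ∀ j, ∀ y ∈ tsupport χ,
      ‖iteratedFDeriv ℝ j F y‖ ≤ C * r ^ j * (j.factorial : ℝ) * M j := fun j y hy => by
    rw [((hFf y hy).iteratedFDeriv ℝ j).eq_of_nhds,
      ← iteratedFDerivWithin_of_isOpen j hU (hχU hy)]
    exact hCr j y hy
  obtain ⟨ρ, hρ, e, he, hest⟩ := exists_norm_iteratedFDeriv_convolution_gaussianKernel_sub_le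
    hM hχ hχc hχ01 hK hχK hF hC.le hr.le hFb
  set G : ℝ → (Fin n → ℝ) → ℝ := fun s =>
    (fun y => χ y • F y) ⋆[(ContinuousLinearMap.lsmul ℝ ℝ).flip, volume] gaussianKernel n s with hG
  have hψ : ContDiff ℝ (⊤ : ℕ∞) fun y => χ y • F y := hχ.smul hF
  have hψc : HasCompactSupport fun y => χ y • F y := hχc.smul_right
  have hGs : ∀ s, ContDiff ℝ (⊤ : ℕ∞) (G s) := fun s =>
    hψc.contDiff_convolution_left _ hψ (contDiff_gaussianKernel s).continuous.locallyIntegrable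
  refine ⟨ρ, hρ, fun j => G (j + 1), fun j =>
    exists_entire_extension_convolution_gaussianKernel hψ.continuous hψc _, ?_⟩
  have hej : Tendsto (fun j : ℕ => ENNReal.ofReal (e (j + 1))) atTop (𝓝 0) := by
    have h : Tendsto (fun j : ℕ => (j : ℝ) + 1) atTop atTop :=
      tendsto_natCast_atTop_atTop.atTop_add tendsto_const_nhds
    simpa using ENNReal.tendsto_ofReal (he.comp h)
  refine tendsto_of_tendsto_of_tendsto_of_le_of_le tendsto_const_nhds hej (fun _ => zero_le)
    fun j => CMNorm_le_ofReal hM.2.1 hρ fun m x hx => ?_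
  have hxs : x ∈ tsupport χ :=
    subset_tsupport _ (by simp [(hχK x hx).self_of_nhds])
  have hfF : f - G (j + 1) =ᶠ[𝓝 x] F - G (j + 1) := (hFf x hxs).symm.sub (EventuallyEq.refl _ _)
  rw [iteratedFDerivWithin_of_isOpen m hU (hKU hx), (hfF.iteratedFDeriv ℝ m).eq_of_nhds,
    iteratedFDeriv_sub_apply (hF.of_le (mod_cast le_top)).contDiffAt
      ((hGs _).of_le (mod_cast le_top)).contDiffAt, norm_sub_rev]
  exact hest _ (by positivity) x hx m
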